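/- Let (Σ, T, μ) be an α-mixing shift system and A_n ∈ ℱ_0^{n-1} a sequence with μ(A_n) > 0 and μ(τ_{A_n} ≤ n) → 0 as n → ∞. Then the normalizing constants λ(A_n) ∈ (0,2] (for which the rescaled hitting time λ(A_n)μ(A_n)τ_{A_n} converges in distribution to the exponential law) satisfy limsup_{n→∞} λ(A_n) ≤ 1. -/

import Mathlib

open MeasureTheory Filter Set
open scoped ENNReal Topology

noncomputable section

/-- First hitting time (at time ≥ 1) of the set `A` under `T`, valued in `ℕ∞`. -/
def hitTime {X : Type*} (T : X → X) (A : Set X) (x : X) : ℕ∞ :=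
  ⨅ k ∈ {k : ℕ | 1 ≤ k ∧ T^[k] x ∈ A}, (k : ℕ∞)

/-- The shift map on one-sided sequences. -/
def shift (𝒜 : Type*) : (ℕ → 𝒜) → (ℕ → 𝒜) := fun x n => x (n + 1)

/-- The σ-algebra `ℱ_m^n` generated by the coordinates `m, …, n`. -/
def coordSigma (𝒜 : Type*) [m𝒜 : MeasurableSpace 𝒜] (m n : ℕ) :
    MeasurableSpace (ℕ → 𝒜) :=
  ⨆ i ∈ Set.Icc m n, m𝒜.comap (fun x => x i)

/-- The α-mixing coefficient `α(g)`. -/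
def alphaMix {𝒜 : Type*} [MeasurableSpace 𝒜] (μ : Measure (ℕ → 𝒜)) (g : ℕ) : ℝ :=
  ⨆ m : ℕ, ⨆ n : ℕ,
    ⨆ A : {A : Set (ℕ → 𝒜) // MeasurableSet[coordSigma 𝒜 0 n] A},
      ⨆ B : {B : Set (ℕ → 𝒜) // MeasurableSet[coordSigma 𝒜 (n + g) (m + g)] B},
        |(μ ((A : Set (ℕ → 𝒜)) ∩ B)).toReal - (μ A).toReal * (μ B).toReal|


/-! ### Real analysis part -/

lemma aux_exp_uniform (F : ℕ → ℝ → ℝ) (δ : ℕ → ℝ) (hδ : Tendsto δ atTop (𝓝 0))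
    (hanti : ∀ n s t, 0 ≤ s → s ≤ t → F n t ≤ F n s)
    (hpos : ∀ n t, 0 ≤ F n t) (h0 : ∀ n, F n 0 = 1)
    (hmul : ∀ᶠ n in atTop, ∀ s t, 0 ≤ s → 0 ≤ t → |F n (s + t) - F n s * F n t| ≤ δ n)
    (h1 : Tendsto (fun n => F n 1) atTop (𝓝 (Real.exp (-1)))) :
    ∀ ε > 0, ∀ᶠ n in atTop, ∀ t, 0 ≤ t → |F n t - Real.exp (-t)| ≤ ε := by
  have hle1 : ∀ n t, 0 ≤ t → F n t ≤ 1 := fun n t ht => by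
    rw [← h0 n]; exact hanti n 0 t le_rfl ht
  -- powers
  have hpow : ∀ u : ℝ, 0 ≤ u → ∀ j : ℕ,
      Tendsto (fun n => F n (j * u) - F n u ^ j) atTop (𝓝 0) := by
    intro u hu j
    have key : ∀ᶠ n in atTop, |F n (j * u) - F n u ^ j| ≤ j * δ n := by
      filter_upwards [hmul] with n hn
      induction j with
      | zero => simp [h0]
      | succ j ih =>
        have a := hn (j * u) u (by positivity) hu
        have e : ((j + 1 : ℕ) : ℝ) * u = j * u + u := by push_cast; ring
        rw [e, pow_succ]
        have e2 : F n (j * u + u) - F n u ^ j * F n u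
            = (F n (j * u + u) - F n (j * u) * F n u)
              + (F n (j * u) - F n u ^ j) * F n u := by ring
        rw [e2]
        refine (abs_add_le _ _).trans ?_
        rw [abs_mul, abs_of_nonneg (hpos n u)]
        have b : |F n (j * u) - F n u ^ j| * F n u ≤ |F n (j * u) - F n u ^ j| :=
          mul_le_of_le_one_right (abs_nonneg _) (hle1 n u hu)
        push_cast
        linarith
    refine squeeze_zero_norm' (by simpa [Real.norm_eq_abs] using key) ?_
    simpa using hδ.const_mul (j : ℝ)
  have hroot : ∀ m : ℕ, 0 < m →
      Tendsto (fun n => F n (1 / (m : ℝ))) atTop (𝓝 (Real.exp (-(1 / (m : ℝ))))) := by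
    intro m hm
    have hm' : (m : ℝ) ≠ 0 := by positivity
    have a := h1.sub (hpow (1 / (m : ℝ)) (by positivity) m)
    have e : ∀ n, F n 1 - (F n (m * (1 / (m : ℝ))) - F n (1 / (m : ℝ)) ^ m)
        = F n (1 / (m : ℝ)) ^ m := by
      intro n
      rw [mul_one_div_cancel hm']; ring
    simp only [e, sub_zero] at a
    have b := a.rpow_const (p := (m : ℝ)⁻¹) (Or.inr (by positivity))
    have e3 : ∀ n, (F n (1 / (m : ℝ)) ^ m) ^ ((m : ℝ)⁻¹) = F n (1 / (m : ℝ)) :=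
      fun n => Real.pow_rpow_inv_natCast (hpos n _) hm.ne'
    simp only [e3] at b
    convert b using 2
    rw [← Real.exp_mul]
    congr 1
    field_simp
  have hgrid : ∀ m : ℕ, 0 < m → ∀ j : ℕ,
      Tendsto (fun n => F n (j * (1 / (m : ℝ)))) atTop
        (𝓝 (Real.exp (-(j * (1 / (m : ℝ)))))) := by
    intro m hm j
    have a := (hpow (1 / (m : ℝ)) (by positivity) j).add ((hroot m hm).pow j)
    simp only [sub_add_cancel, zero_add] at a
    convert a using 2
    rw [← Real.exp_nat_mul]
    congr 1
    ring
  intro ε hε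
  obtain ⟨m, hm⟩ : ∃ m : ℕ, 4 / ε < m := exists_nat_gt _
  have hm0' : (0 : ℝ) < m := lt_trans (by positivity) hm
  have hm0 : 0 < m := by exact_mod_cast hm0'
  have hmε : 1 / (m : ℝ) ≤ ε / 4 := by
    rw [div_lt_iff₀ hε] at hm
    rw [div_le_iff₀ hm0']; linarith
  have hall : ∀ᶠ n in atTop, ∀ j ∈ Finset.range (m ^ 2 + 1),
      |F n (j * (1 / (m : ℝ))) - Real.exp (-(j * (1 / (m : ℝ))))| ≤ ε / 4 := by
    rw [Filter.eventually_all_finset]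
    intro j _
    have := (Metric.tendsto_nhds.mp (hgrid m hm0 j)) (ε / 4) (by positivity)
    filter_upwards [this] with n hn
    rw [Real.dist_eq] at hn
    exact hn.le
  filter_upwards [hall] with n hn t ht
  set u : ℝ := 1 / (m : ℝ) with hu
  have hu0 : 0 < u := by positivity
  have hmu : (m : ℝ) * u = 1 := by rw [hu]; field_simp
  by_cases hc : (m : ℝ) ≤ t
  · have a := hn (m ^ 2) (by simp)
    have e : ((m ^ 2 : ℕ) : ℝ) * u = m := by
      push_cast; rw [pow_two, mul_assoc, hmu, mul_one]
    rw [e] at a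
    have b := hanti n m t hm0'.le hc
    have c : Real.exp (-t) ≤ Real.exp (-(m : ℝ)) := Real.exp_le_exp.mpr (by linarith)
    have d : Real.exp (-(m : ℝ)) ≤ u := by
      rw [Real.exp_neg, hu, one_div]
      apply inv_anti₀ hm0'
      linarith [Real.add_one_le_exp (m : ℝ)]
    have := hpos n t
    have := Real.exp_pos (-t)
    rw [abs_le] at a ⊢
    constructor <;> linarith
  · push Not at hc
    set j := ⌊t * m⌋₊ with hj
    have hjle : (j : ℝ) ≤ t * m := Nat.floor_le (by positivity)
    have hjlt : t * m < j + 1 := Nat.lt_floor_add_one _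
    have hjm : j < m ^ 2 := by
      have : (j : ℝ) < (m : ℝ) ^ 2 := by nlinarith
      exact_mod_cast this
    have a := hn j (by simp; omega)
    have a' := hn (j + 1) (by simp; omega)
    have l1 : (j : ℝ) * u ≤ t := by nlinarith
    have l2 : t ≤ ((j + 1 : ℕ) : ℝ) * u := by push_cast; nlinarith
    have b := hanti n _ t (by positivity) l1
    have b' := hanti n t _ ht l2
    have c : Real.exp (-t) ≤ Real.exp (-(j * u)) := Real.exp_le_exp.mpr (by linarith)
    have c' : Real.exp (-(((j + 1 : ℕ) : ℝ) * u)) ≤ Real.exp (-t) :=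
      Real.exp_le_exp.mpr (by linarith)
    have d : Real.exp (-(j * u)) - Real.exp (-(((j + 1 : ℕ) : ℝ) * u)) ≤ u := by
      have e : -(((j + 1 : ℕ) : ℝ) * u) = -(j * u) + (-u) := by push_cast; ring
      rw [e, Real.exp_add]
      have p1 : Real.exp (-(j * u)) ≤ 1 := Real.exp_le_one_iff.mpr (by
        have : 0 ≤ j * u := by positivity
        linarith)
      have p2 := Real.exp_pos (-(j * u))
      have p3 := Real.add_one_le_exp (-u)
      nlinarith
    rw [abs_le] at a a' ⊢
    constructor <;> linarith

/-! ### Hitting times -/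

/-- The points which do not visit `A` at times `1, …, k`. -/
def noHit (𝒜 : Type*) (A : Set (ℕ → 𝒜)) (k : ℕ) : Set (ℕ → 𝒜) :=
  {x | ∀ j, 1 ≤ j → j ≤ k → (shift 𝒜)^[j] x ∉ A}

lemma lt_hitTime_iff {𝒜 : Type*} (A : Set (ℕ → 𝒜)) (k : ℕ) (x : ℕ → 𝒜) :
    (k : ℕ∞) < hitTime (shift 𝒜) A x ↔ x ∈ noHit 𝒜 A k := by
  unfold hitTime noHit
  constructor
  · intro h j hj1 hjk hA
    have : (⨅ k ∈ {k : ℕ | 1 ≤ k ∧ (shift 𝒜)^[k] x ∈ A}, (k : ℕ∞)) ≤ (j : ℕ∞) :=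
      iInf₂_le j ⟨hj1, hA⟩
    have h2 := lt_of_lt_of_le h this
    have : k < j := by exact_mod_cast h2
    omega
  · intro h
    have : ((k + 1 : ℕ) : ℕ∞) ≤
        (⨅ k ∈ {k : ℕ | 1 ≤ k ∧ (shift 𝒜)^[k] x ∈ A}, (k : ℕ∞)) := by
      refine le_iInf₂ fun j hj => ?_
      have : k < j := by
        by_contra hc
        exact h j hj.1 (by omega) hj.2
      exact_mod_cast this
    refine lt_of_lt_of_le ?_ this
    exact_mod_cast Nat.lt_succ_self k

lemma noHit_add {𝒜 : Type*} (A : Set (ℕ → 𝒜)) (s t : ℕ) :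
    noHit 𝒜 A (s + t) = noHit 𝒜 A s ∩ (shift 𝒜)^[s] ⁻¹' noHit 𝒜 A t := by
  ext x
  simp only [noHit, mem_setOf_eq, mem_inter_iff, mem_preimage, ← Function.iterate_add_apply]
  constructor
  · intro h
    exact ⟨fun j h1 h2 => h j h1 (by omega), fun j h1 h2 => h (j + s) (by omega) (by omega)⟩
  · rintro ⟨h1, h2⟩ j hj1 hj2
    by_cases hc : j ≤ s
    · exact h1 j hj1 hc
    · have := h2 (j - s) (by omega) (by omega)
      rwa [Nat.sub_add_cancel (by omega)] at this

lemma shift_iterate_apply {𝒜 : Type*} (j : ℕ) (x : ℕ → 𝒜) (i : ℕ) :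
    (shift 𝒜)^[j] x i = x (i + j) := by
  induction j generalizing x with
  | zero => rfl
  | succ j ih =>
    rw [Function.iterate_succ_apply, ih]
    simp only [shift]
    congr 1

section coord

variable {𝒜 : Type*} [m𝒜 : MeasurableSpace 𝒜]

lemma coordSigma_mono {a b a' b' : ℕ} (h1 : a' ≤ a) (h2 : b ≤ b') :
    coordSigma 𝒜 a b ≤ coordSigma 𝒜 a' b' := by
  unfold coordSigma
  exact biSup_mono (fun i hi => ⟨h1.trans hi.1, hi.2.trans h2⟩)

lemma coordSigma_le (a b : ℕ) : coordSigma 𝒜 a b ≤ MeasurableSpace.pi := by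
  unfold coordSigma
  refine iSup₂_le fun i _ => ?_
  exact (measurable_pi_apply i).comap_le

lemma coordSigma_preimage (a b j : ℕ) {B : Set (ℕ → 𝒜)}
    (hB : MeasurableSet[coordSigma 𝒜 a b] B) :
    MeasurableSet[coordSigma 𝒜 (a + j) (b + j)] ((shift 𝒜)^[j] ⁻¹' B) := by
  have : (coordSigma 𝒜 a b).comap ((shift 𝒜)^[j]) ≤ coordSigma 𝒜 (a + j) (b + j) := by
    unfold coordSigma
    simp only [MeasurableSpace.comap_iSup, MeasurableSpace.comap_comp]
    refine iSup₂_le fun i hi => ?_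
    have e : (fun x : ℕ → 𝒜 => x i) ∘ (shift 𝒜)^[j] = fun x => x (i + j) := by
      funext x
      exact shift_iterate_apply j x i
    rw [e]
    exact le_iSup₂_of_le (i + j)
      ⟨Nat.add_le_add_right hi.1 j, Nat.add_le_add_right hi.2 j⟩ le_rfl
  exact this _ ⟨B, hB, rfl⟩

lemma noHit_meas {A : Set (ℕ → 𝒜)} {p : ℕ} (hA : MeasurableSet[coordSigma 𝒜 0 p] A) (k : ℕ) :
    MeasurableSet[coordSigma 𝒜 0 (k + p)] (noHit 𝒜 A k) := by
  have e : noHit 𝒜 A k = ⋂ j ∈ Finset.Icc 1 k, ((shift 𝒜)^[j] ⁻¹' A)ᶜ := by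
    ext x
    simp [noHit]
  rw [e]
  refine Finset.measurableSet_biInter _ fun j hj => ?_
  rw [Finset.mem_Icc] at hj
  refine MeasurableSet.compl ?_
  exact coordSigma_mono (Nat.zero_le _) (by omega) _ (coordSigma_preimage 0 p j hA)

lemma noHit_meas' {A : Set (ℕ → 𝒜)} {p : ℕ} (hA : MeasurableSet[coordSigma 𝒜 0 p] A) (k : ℕ) :
    MeasurableSet (noHit 𝒜 A k) :=
  coordSigma_le _ _ _ (noHit_meas hA k)

variable (μ : Measure (ℕ → 𝒜)) [IsProbabilityMeasure μ]

lemma alpha_term_le (A B : Set (ℕ → 𝒜)) :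
    |μ.real (A ∩ B) - μ.real A * μ.real B| ≤ 1 := by
  have h1 : μ.real (A ∩ B) ≤ 1 := measureReal_le_one
  have h2 : 0 ≤ μ.real (A ∩ B) := measureReal_nonneg
  have h3 : μ.real A ≤ 1 := measureReal_le_one
  have h4 : 0 ≤ μ.real A := measureReal_nonneg
  have h5 : μ.real B ≤ 1 := measureReal_le_one
  have h6 : 0 ≤ μ.real B := measureReal_nonneg
  rw [abs_le]
  constructor <;> nlinarith

lemma le_alphaMix (g m n : ℕ) {A B : Set (ℕ → 𝒜)}
    (hA : MeasurableSet[coordSigma 𝒜 0 n] A)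
    (hB : MeasurableSet[coordSigma 𝒜 (n + g) (m + g)] B) :
    |μ.real (A ∩ B) - μ.real A * μ.real B| ≤ alphaMix μ g := by
  unfold alphaMix
  have t := fun A B => alpha_term_le μ A B
  simp only [measureReal_def] at t ⊢
  have l4 : ∀ n m (A : {A : Set (ℕ → 𝒜) // MeasurableSet[coordSigma 𝒜 0 n] A}),
      (⨆ B : {B : Set (ℕ → 𝒜) // MeasurableSet[coordSigma 𝒜 (n + g) (m + g)] B},
        |(μ ((A : Set (ℕ → 𝒜)) ∩ B)).toReal - (μ A).toReal * (μ B).toReal|) ≤ 1 :=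
    fun n m A => Real.iSup_le (fun B => t _ _) zero_le_one
  have l3 := fun n m => Real.iSup_le (fun A => l4 n m A) zero_le_one
  have l2 := fun m => Real.iSup_le (fun n => l3 n m) zero_le_one
  refine le_ciSup_of_le ⟨1, ?_⟩ m ?_
  · rintro _ ⟨m, rfl⟩; exact l2 m
  refine le_ciSup_of_le ⟨1, ?_⟩ n ?_
  · rintro _ ⟨n, rfl⟩; exact l3 n m
  refine le_ciSup_of_le ⟨1, ?_⟩ ⟨A, hA⟩ ?_
  · rintro _ ⟨A, rfl⟩; exact l4 n m A
  refine le_ciSup_of_le ⟨1, ?_⟩ ⟨B, hB⟩ le_rfl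
  rintro _ ⟨B, rfl⟩; exact t _ _

variable {μ} {A : Set (ℕ → 𝒜)} {p : ℕ}

lemma real_preimage (hT : MeasurePreserving (shift 𝒜) μ μ) (s : ℕ) {B : Set (ℕ → 𝒜)}
    (hB : MeasurableSet B) : μ.real ((shift 𝒜)^[s] ⁻¹' B) = μ.real B := by
  rw [measureReal_def, measureReal_def, (hT.iterate s).measure_preimage hB.nullMeasurableSet]

lemma noHit_zero : noHit 𝒜 A 0 = univ := by
  ext x
  simp only [noHit, mem_setOf_eq, mem_univ, iff_true]
  intro j h1 h2; omega

lemma noHit_anti {s t : ℕ} (h : s ≤ t) : noHit 𝒜 A t ⊆ noHit 𝒜 A s :=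
  fun _ hx j h1 h2 => hx j h1 (h2.trans h)

/-- Generic loss estimate. -/
lemma inter_loss (hT : MeasurePreserving (shift 𝒜) μ μ) (s : ℕ) {B C : Set (ℕ → 𝒜)}
    (hC : MeasurableSet C) :
    μ.real B ≤ μ.real (B ∩ (shift 𝒜)^[s] ⁻¹' C) + (1 - μ.real C) := by
  have h : B ⊆ (B ∩ (shift 𝒜)^[s] ⁻¹' C) ∪ (shift 𝒜)^[s] ⁻¹' Cᶜ := by
    intro x hx
    by_cases hc : x ∈ (shift 𝒜)^[s] ⁻¹' C
    · exact Or.inl ⟨hx, hc⟩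
    · exact Or.inr hc
  refine (measureReal_mono h).trans ((measureReal_union_le _ _).trans ?_)
  rw [real_preimage hT s hC.compl, probReal_compl_eq_one_sub hC]


lemma H_jump (hT : MeasurePreserving (shift 𝒜) μ μ)
    (hA : MeasurableSet[coordSigma 𝒜 0 p] A) (s t : ℕ) :
    μ.real (noHit 𝒜 A s) ≤ μ.real (noHit 𝒜 A (s + t)) + (1 - μ.real (noHit 𝒜 A t)) := by
  rw [noHit_add]
  exact inter_loss hT s (noHit_meas' hA t)

lemma H_one (hT : MeasurePreserving (shift 𝒜) μ μ)
    (hA : MeasurableSet[coordSigma 𝒜 0 p] A) : μ.real (noHit 𝒜 A 1) = 1 - μ.real A := by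
  have hA' : MeasurableSet A := coordSigma_le _ _ _ hA
  have e : noHit 𝒜 A 1 = (shift 𝒜)^[1] ⁻¹' Aᶜ := by
    ext x
    simp only [noHit, mem_setOf_eq, mem_preimage, mem_compl_iff]
    constructor
    · intro h; exact h 1 le_rfl le_rfl
    · intro h j h1 h2
      obtain rfl : j = 1 := by omega
      exact h
  rw [e, real_preimage hT 1 hA'.compl, probReal_compl_eq_one_sub hA']

lemma H_linear (hT : MeasurePreserving (shift 𝒜) μ μ)
    (hA : MeasurableSet[coordSigma 𝒜 0 p] A) (k : ℕ) : 1 - μ.real (noHit 𝒜 A k) ≤ k * μ.real A := by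
  induction k with
  | zero => simp [noHit_zero]
  | succ k ih =>
    have := H_jump hT hA k 1
    rw [H_one hT hA] at this
    push_cast
    linarith

lemma H_gap (hT : MeasurePreserving (shift 𝒜) μ μ)
    (hA : MeasurableSet[coordSigma 𝒜 0 p] A) (g s r : ℕ) :
    |μ.real (noHit 𝒜 A s ∩ (shift 𝒜)^[s + p + g] ⁻¹' noHit 𝒜 A r)
      - μ.real (noHit 𝒜 A s) * μ.real (noHit 𝒜 A r)| ≤ alphaMix μ g := by
  have h := le_alphaMix μ g ((r + p) + (s + p)) (s + p) (noHit_meas hA s)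
    (B := (shift 𝒜)^[s + p + g] ⁻¹' noHit 𝒜 A r) (by
      have := coordSigma_preimage 0 (r + p) (s + p + g) (noHit_meas hA r)
      exact coordSigma_mono (by omega) (by omega) _ this)
  rwa [real_preimage hT _ (noHit_meas' hA r)] at h

lemma H_mul (hT : MeasurePreserving (shift 𝒜) μ μ)
    (hA : MeasurableSet[coordSigma 𝒜 0 p] A) (g s t : ℕ) :
    |μ.real (noHit 𝒜 A (s + t)) - μ.real (noHit 𝒜 A s) * μ.real (noHit 𝒜 A t)|
      ≤ 2 * (1 - μ.real (noHit 𝒜 A (p + g))) + alphaMix μ g := by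
  have hα : 0 ≤ alphaMix μ g := (abs_nonneg _).trans (H_gap hT hA g 0 0)
  have n0 : ∀ k, 0 ≤ μ.real (noHit 𝒜 A k) := fun k => measureReal_nonneg
  have n1 : ∀ k, μ.real (noHit 𝒜 A k) ≤ 1 := fun k => measureReal_le_one
  have anti : ∀ {a b : ℕ}, a ≤ b → μ.real (noHit 𝒜 A b) ≤ μ.real (noHit 𝒜 A a) :=
    fun h => measureReal_mono (noHit_anti h)
  by_cases hc : t ≤ p + g
  · have a := H_jump hT hA s t
    have b := anti (Nat.le_add_right s t)
    have c := anti hc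
    have d := n0 s
    have e := n1 s
    have f := n1 t
    have f' := n1 (p + g)
    have q : μ.real (noHit 𝒜 A s) * (1 - μ.real (noHit 𝒜 A t)) ≤ 1 - μ.real (noHit 𝒜 A t) :=
      mul_le_of_le_one_left (by linarith) e
    have q' : 0 ≤ μ.real (noHit 𝒜 A s) * (1 - μ.real (noHit 𝒜 A t)) :=
      mul_nonneg d (by linarith)
    rw [abs_le]
    constructor <;> nlinarith
  · obtain ⟨r, rfl⟩ : ∃ r, t = p + g + r := ⟨t - (p + g), by omega⟩
    have a := H_gap hT hA g s r
    have b := inter_loss hT s (B := noHit 𝒜 A s ∩ (shift 𝒜)^[s + p + g] ⁻¹' noHit 𝒜 A r)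
      (noHit_meas' hA (p + g))
    have e : noHit 𝒜 A s ∩ (shift 𝒜)^[s + p + g] ⁻¹' noHit 𝒜 A r
        ∩ (shift 𝒜)^[s] ⁻¹' noHit 𝒜 A (p + g) = noHit 𝒜 A (s + (p + g + r)) := by
      have : s + (p + g + r) = (s + (p + g)) + r := by omega
      rw [this, noHit_add A (s + (p + g)), noHit_add A s (p + g)]
      rw [← Nat.add_assoc s p g]
      ext x; simp only [mem_inter_iff]; tauto
    rw [e] at b
    have b' : μ.real (noHit 𝒜 A (s + (p + g + r))) ≤
        μ.real (noHit 𝒜 A s ∩ (shift 𝒜)^[s + p + g] ⁻¹' noHit 𝒜 A r) := by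
      rw [← e]; exact measureReal_mono inter_subset_left
    have c := H_jump hT hA r (p + g)
    rw [Nat.add_comm r] at c
    have c' := anti (Nat.le_add_left r (p + g))
    have d := n0 s
    have f := n1 s
    have q : μ.real (noHit 𝒜 A s) * (μ.real (noHit 𝒜 A r) - μ.real (noHit 𝒜 A (p + g + r)))
        ≤ μ.real (noHit 𝒜 A r) - μ.real (noHit 𝒜 A (p + g + r)) :=
      mul_le_of_le_one_left (by linarith) f
    have q' : 0 ≤ μ.real (noHit 𝒜 A s) *
        (μ.real (noHit 𝒜 A r) - μ.real (noHit 𝒜 A (p + g + r))) :=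
      mul_nonneg d (by linarith)
    have f' := n1 (p + g)
    rw [mul_sub] at q q'
    rw [abs_le] at a ⊢
    constructor <;> linarith

lemma H_tendsto (hT : MeasurePreserving (shift 𝒜) μ μ)
    (hA : MeasurableSet[coordSigma 𝒜 0 p] A) (hmix : Tendsto (alphaMix μ) atTop (𝓝 0)) (hApos : 0 < μ.real A) :
    Tendsto (fun k => μ.real (noHit 𝒜 A k)) atTop (𝓝 0) := by
  have n0 : ∀ k, 0 ≤ μ.real (noHit 𝒜 A k) := fun k => measureReal_nonneg
  have anti : Antitone (fun k => μ.real (noHit 𝒜 A k)) :=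
    fun a b h => measureReal_mono (noHit_anti h)
  have bdd : BddBelow (range fun k => μ.real (noHit 𝒜 A k)) :=
    ⟨0, by rintro _ ⟨k, rfl⟩; exact n0 k⟩
  have hL := tendsto_atTop_ciInf anti bdd
  set L := ⨅ k, μ.real (noHit 𝒜 A k) with hLdef
  have L0 : 0 ≤ L := le_ciInf n0
  have L1 : L ≤ 1 - μ.real A := by
    rw [← H_one hT hA]; exact ciInf_le bdd 1
  have hg : ∀ g, L ≤ L * L + alphaMix μ g := by
    intro g
    have h1 : ∀ k, L ≤ μ.real (noHit 𝒜 A k) * μ.real (noHit 𝒜 A k) + alphaMix μ g := by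
      intro k
      have a := (abs_le.mp (H_gap hT hA g k k)).2
      have b : μ.real (noHit 𝒜 A (k + p + g + k)) ≤
          μ.real (noHit 𝒜 A k ∩ (shift 𝒜)^[k + p + g] ⁻¹' noHit 𝒜 A k) := by
        refine measureReal_mono ?_
        rw [noHit_add]
        exact inter_subset_inter_left _ (noHit_anti (by omega))
      have c : L ≤ μ.real (noHit 𝒜 A (k + p + g + k)) := ciInf_le bdd _
      linarith
    exact ge_of_tendsto' ((hL.mul hL).add_const _) h1
  have hLL : L ≤ L * L := by
    have := ge_of_tendsto' (hmix.const_add (L * L)) hg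
    simpa using this
  have : L = 0 := by nlinarith
  rwa [this] at hL

end coord

lemma scaled_iff {c μA : ℝ≥0∞} {k : ℕ} (hk : 0 < k) (hc : c * μA = ((k : ℝ≥0∞))⁻¹)
    (τ : ℕ∞) (t : ℝ) (ht : 0 ≤ t) :
    ENNReal.ofReal t < c * μA * (τ : ℝ≥0∞) ↔ ((⌊t * k⌋₊ : ℕ) : ℕ∞) < τ := by
  rw [hc]
  have hk' : (0 : ℝ) < k := by exact_mod_cast hk
  induction τ using ENat.recTopCoe with
  | top =>
    have : ((k : ℝ≥0∞))⁻¹ * ((⊤ : ℕ∞) : ℝ≥0∞) = ⊤ := by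
      rw [ENat.toENNReal_top, ENNReal.mul_top]
      simp
    rw [this]
    simp
  | coe m =>
    have e : ((k : ℝ≥0∞))⁻¹ * (((m : ℕ) : ℕ∞) : ℝ≥0∞) = ENNReal.ofReal ((k : ℝ)⁻¹ * m) := by
      rw [ENNReal.ofReal_mul (by positivity), ENNReal.ofReal_inv_of_pos hk']
      simp
    rw [e, ENNReal.ofReal_lt_ofReal_iff_of_nonneg ht, Nat.cast_lt, Nat.floor_lt (by positivity),
      inv_mul_eq_div, lt_div_iff₀ hk']

/-- For an α-mixing shift system and sets `A n ∈ ℱ_0^{n-1}` of positive measure with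
`μ(τ_{A_n} ≤ n) → 0`, the normalizing constants `lam n ∈ (0,2]` for which the rescaled
hitting time `lam(A_n)μ(A_n)τ_{A_n}` converges in distribution to the exponential law
satisfy `limsup_{n→∞} lam n ≤ 1`. -/
theorem limsup_normalizing_constant_le_one
    {𝒜 : Type*} [Countable 𝒜] [MeasurableSpace 𝒜] [DiscreteMeasurableSpace 𝒜]
    (μ : Measure (ℕ → 𝒜)) [IsProbabilityMeasure μ]
    (hT : MeasurePreserving (shift 𝒜) μ μ)
    (hmix : Tendsto (alphaMix μ) atTop (𝓝 0))
    (A : ℕ → Set (ℕ → 𝒜))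
    (hAmeas : ∀ n, MeasurableSet[coordSigma 𝒜 0 (n - 1)] (A n))
    (hApos : ∀ n, 0 < μ (A n))
    (hshort : Tendsto
      (fun n => (μ {x | hitTime (shift 𝒜) (A n) x ≤ (n : ℕ∞)}).toReal) atTop (𝓝 0)) :
    ∃ lam : ℕ → ℝ, (∀ n, lam n ∈ Set.Ioc (0 : ℝ) 2) ∧
      -- the constants `lam` give the exponential law for the rescaled hitting time …
      Tendsto
        (fun n => ⨆ t : {t : ℝ // 0 ≤ t},
          |(μ {x | ENNReal.ofReal (t : ℝ) <
              ENNReal.ofReal (lam n) * μ (A n) *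
                (hitTime (shift 𝒜) (A n) x : ℝ≥0∞)}).toReal -
            Real.exp (-(t : ℝ))|) atTop (𝓝 0) ∧
      -- … and satisfy `limsup lam ≤ 1`:
      Filter.limsup lam atTop ≤ 1 := by
  have hApos' : ∀ n, 0 < μ.real (A n) := fun n =>
    ENNReal.toReal_pos (hApos n).ne' (measure_ne_top _ _)
  set H : ℕ → ℕ → ℝ := fun n k => μ.real (noHit 𝒜 (A n) k) with hH
  have H0 : ∀ n k, 0 ≤ H n k := fun n k => measureReal_nonneg
  have H1 : ∀ n k, H n k ≤ 1 := fun n k => measureReal_le_one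
  have Hz : ∀ n, H n 0 = 1 := fun n => by simp [hH, noHit_zero]
  have Hanti : ∀ n {a b : ℕ}, a ≤ b → H n b ≤ H n a :=
    fun n a b h => measureReal_mono (noHit_anti h)
  have e1 : Real.exp (-1) < 1 := by rw [Real.exp_lt_one_iff]; norm_num
  have ehalf : Real.exp (-1) ≤ 1 / 2 := by
    rw [Real.exp_neg, one_div]
    apply inv_anti₀ two_pos
    linarith [Real.add_one_le_exp (1 : ℝ)]
  have hex : ∀ n, ∃ k, H n k ≤ Real.exp (-1) := by
    intro n
    have := (H_tendsto hT (hAmeas n) hmix (hApos' n)).eventually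
      (gt_mem_nhds (Real.exp_pos (-1)))
    obtain ⟨k, hk⟩ := this.exists
    exact ⟨k, hk.le⟩
  classical
  set K : ℕ → ℕ := fun n => Nat.find (hex n) with hK
  have hKspec : ∀ n, H n (K n) ≤ Real.exp (-1) := fun n => Nat.find_spec (hex n)
  have hKpos : ∀ n, 0 < K n := by
    intro n
    rw [Nat.pos_iff_ne_zero]
    intro h
    have := hKspec n
    rw [h, Hz] at this
    linarith
  have hKmin : ∀ n, Real.exp (-1) < H n (K n - 1) := by
    intro n
    have := Nat.find_min (hex n) (m := K n - 1) (by have := hKpos n; simp only [hK] at this ⊢; omega)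
    exact not_le.mp this
  have hKpos' : ∀ n, (0 : ℝ) < K n := fun n => by exact_mod_cast hKpos n
  -- short hits
  set q : ℕ → ℝ := fun n => 1 - H n n with hq
  have hq0 : Tendsto q atTop (𝓝 0) := by
    refine hshort.congr fun n => ?_
    have e : {x | hitTime (shift 𝒜) (A n) x ≤ (n : ℕ∞)} = (noHit 𝒜 (A n) n)ᶜ := by
      ext x
      rw [mem_setOf_eq, mem_compl_iff, ← lt_hitTime_iff, not_lt]
    rw [e]
    exact probReal_compl_eq_one_sub (noHit_meas' (hAmeas n) n)
  set ε : ℕ → ℝ := fun n => 4 * q n + alphaMix μ n with hε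
  have hε0 : Tendsto ε atTop (𝓝 0) := by
    simpa using (hq0.const_mul 4).add hmix
  have hmul : ∀ n s t, |H n (s + t) - H n s * H n t| ≤ ε n := by
    intro n s t
    have a := H_mul hT (hAmeas n) n s t
    have b := H_jump hT (hAmeas n) n n
    have c := Hanti n (show n - 1 + n ≤ n + n by omega)
    simp only [hH, hε, hq] at a b c ⊢
    linarith
  have hstep : ∀ n, 1 ≤ n → ∀ k, H n k ≤ H n (k + 1) + q n := by
    intro n hn k
    have b := H_jump hT (hAmeas n) k 1
    have c := Hanti n hn
    simp only [hH, hq] at b c ⊢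
    linarith
  set F : ℕ → ℝ → ℝ := fun n t => H n ⌊t * K n⌋₊ with hF
  have hunif : ∀ e > 0, ∀ᶠ n in atTop, ∀ t, 0 ≤ t → |F n t - Real.exp (-t)| ≤ e := by
    refine aux_exp_uniform F (fun n => ε n + q n) (by simpa using hε0.add hq0) ?_ ?_ ?_ ?_ ?_
    · intro n s t _ hst
      exact Hanti n (Nat.floor_mono (mul_le_mul_of_nonneg_right hst (hKpos' n).le))
    · intro n t; exact H0 _ _
    · intro n; simp [hF, Hz]
    · filter_upwards [eventually_ge_atTop 1] with n hn s t hs ht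
      have a := hmul n ⌊s * K n⌋₊ ⌊t * K n⌋₊
      have hs' : 0 ≤ s * K n := mul_nonneg hs (hKpos' n).le
      have ht' : 0 ≤ t * K n := mul_nonneg ht (hKpos' n).le
      have l1 : ⌊s * K n⌋₊ + ⌊t * K n⌋₊ ≤ ⌊(s + t) * K n⌋₊ := by
        rw [add_mul]; exact Nat.le_floor (by
          push_cast; exact add_le_add (Nat.floor_le hs') (Nat.floor_le ht'))
      have l2 : ⌊(s + t) * K n⌋₊ ≤ ⌊s * K n⌋₊ + ⌊t * K n⌋₊ + 1 := by
        have : ⌊(s + t) * K n⌋₊ < ⌊s * K n⌋₊ + ⌊t * K n⌋₊ + 2 := by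
          rw [Nat.floor_lt (by rw [add_mul]; positivity), add_mul]
          push_cast
          linarith [Nat.lt_floor_add_one (s * K n), Nat.lt_floor_add_one (t * K n)]
        omega
      have b := Hanti n l1
      have c := Hanti n l2
      have d := hstep n hn (⌊s * K n⌋₊ + ⌊t * K n⌋₊)
      have hqn : 0 ≤ q n := by simp only [hq]; linarith [H1 n n]
      simp only [hF]
      rw [abs_le] at a ⊢
      constructor <;> linarith
    · have up : ∀ n, F n 1 ≤ Real.exp (-1) := by
        intro n; simp only [hF, one_mul, Nat.floor_natCast]; exact hKspec n
      have low : ∀ᶠ n in atTop, Real.exp (-1) - q n ≤ F n 1 := by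
        filter_upwards [eventually_ge_atTop 1] with n hn
        have a := hstep n hn (K n - 1)
        rw [Nat.sub_add_cancel (hKpos n)] at a
        simp only [hF, one_mul, Nat.floor_natCast]
        linarith [hKmin n]
      refine tendsto_of_tendsto_of_tendsto_of_le_of_le' ?_ tendsto_const_nhds low
        (Eventually.of_forall up)
      simpa using hq0.const_sub (Real.exp (-1))
  set lam : ℕ → ℝ := fun n => (K n * μ.real (A n))⁻¹ with hlam
  have hlpos : ∀ n, 0 < lam n := fun n => inv_pos.mpr (mul_pos (hKpos' n) (hApos' n))
  have hlin : ∀ n t, 0 ≤ t → lam n * (1 - F n t) ≤ t := by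
    intro n t ht
    have a := H_linear hT (hAmeas n) ⌊t * K n⌋₊
    have b : (⌊t * K n⌋₊ : ℝ) ≤ t * K n := Nat.floor_le (mul_nonneg ht (hKpos' n).le)
    have c : 1 - F n t ≤ t * (K n * μ.real (A n)) := by
      rw [← mul_assoc]
      exact a.trans (mul_le_mul_of_nonneg_right b (hApos' n).le)
    simp only [hlam]
    rw [inv_mul_le_iff₀ (mul_pos (hKpos' n) (hApos' n))]
    linarith
  have hl2 : ∀ n, lam n ≤ 2 := by
    intro n
    have a := hlin n 1 zero_le_one
    have b : F n 1 ≤ 1 / 2 := by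
      simp only [hF, one_mul, Nat.floor_natCast]; exact (hKspec n).trans ehalf
    nlinarith [hlpos n]
  refine ⟨lam, fun n => ⟨hlpos n, hl2 n⟩, ?_, ?_⟩
  · have hset : ∀ n (t : {t : ℝ // 0 ≤ t}), (μ {x | ENNReal.ofReal (t : ℝ) <
              ENNReal.ofReal (lam n) * μ (A n) *
                (hitTime (shift 𝒜) (A n) x : ℝ≥0∞)}).toReal = F n t := by
      intro n t
      have hc : ENNReal.ofReal (lam n) * μ (A n) = ((K n : ℝ≥0∞))⁻¹ := by
        have : μ (A n) = ENNReal.ofReal (μ.real (A n)) := by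
          rw [measureReal_def, ENNReal.ofReal_toReal (measure_ne_top _ _)]
        rw [this, ← ENNReal.ofReal_mul (hlpos n).le]
        have e : lam n * μ.real (A n) = (K n : ℝ)⁻¹ := by
          simp only [hlam]
          have := (hApos' n).ne'
          have := (hKpos' n).ne'
          field_simp
        rw [e, ENNReal.ofReal_inv_of_pos (hKpos' n)]
        simp
      have e : {x | ENNReal.ofReal (t : ℝ) < ENNReal.ofReal (lam n) * μ (A n) *
          (hitTime (shift 𝒜) (A n) x : ℝ≥0∞)} = noHit 𝒜 (A n) ⌊(t : ℝ) * K n⌋₊ := by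
        ext x
        rw [mem_setOf_eq, scaled_iff (hKpos n) hc _ _ t.2, lt_hitTime_iff]
      rw [e]
      rfl
    simp only [hset]
    rw [Metric.tendsto_nhds]
    intro e he
    filter_upwards [hunif (e / 2) (by positivity)] with n hn
    rw [Real.dist_eq, sub_zero, abs_of_nonneg (Real.iSup_nonneg fun t => abs_nonneg _)]
    refine lt_of_le_of_lt (Real.iSup_le (fun t => hn t t.2) (by positivity)) (half_lt_self he)
  · refine le_of_forall_gt_imp_ge_of_dense fun c hc => ?_
    refine Filter.limsup_le_of_le ?_ ?_
    · exact isCoboundedUnder_le_of_le atTop (fun n => (hlpos n).le)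
    · set t := (c - 1) / 2 with ht
      have ht0 : 0 < t := by rw [ht]; linarith
      have hct : c = 1 + 2 * t := by rw [ht]; ring
      have hexp : Real.exp (-t) ≤ 1 / (1 + t) := by
        rw [Real.exp_neg, one_div]
        exact inv_anti₀ (by linarith) (by linarith [Real.add_one_le_exp t])
      have hgap : 0 < 1 - Real.exp (-t) - t / c := by
        have : 1 / (1 + t) + t / c < 1 := by
          rw [hct, div_add_div _ _ (by positivity) (by positivity), div_lt_one (by positivity)]
          nlinarith
        linarith
      filter_upwards [hunif _ hgap] with n hn
      have a := hlin n t ht0.le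
      have b := (abs_le.mp (hn t ht0.le)).2
      have d : t / c ≤ 1 - F n t := by linarith
      have c0 : 0 < c := by linarith
      have f : lam n * (t / c) ≤ t := (mul_le_mul_of_nonneg_left d (hlpos n).le).trans a
      rw [← mul_div_assoc, div_le_iff₀ c0] at f
      nlinarith
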